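/- arXiv:2503.09558 — 2 statements merged into one kernel-verified Lean document; each statement's English description precedes it below -/
import Mathlib

section
/- Main Theorem. Let G be a connected graph with even loop number ℓ ≥ 0, let 𝒞 be a cycle incidence matrix of G, and let 𝒫 be any m × (n−1) integer matrix with 𝒫ᵀ 𝕀 = 1_{n−1} (for instance a path matrix). Then the topological form and the Pfaffian form satisfy α_G = (det[𝒞|𝒫] / 2^ℓ) · φ_G, and moreover det[𝒞|𝒫] ∈ {+1, −1}. -/
open Matrix BigOperators

namespace GraphForms

/-- Vertices `x` and `y` are connected using only edges in `T` (in either direction). -/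
def Conn (m n : ℕ) (s t : Fin m → Fin n) (T : Set (Fin m)) (x y : Fin n) : Prop :=
  Relation.ReflTransGen
    (fun a b => ∃ e ∈ T, (s e = a ∧ t e = b) ∨ (s e = b ∧ t e = a)) x y

/-- The graph is connected. -/
def IsConnectedGraph (m n : ℕ) (s t : Fin m → Fin n) : Prop :=
  ∀ x y, Conn m n s t Set.univ x y

/-- `T ⊆ E` is a spanning tree: it has `n - 1` edges and connects all vertices. -/
def IsSpanningTree (m n : ℕ) (s t : Fin m → Fin n) (T : Finset (Fin m)) : Prop :=
  T.card = n - 1 ∧ ∀ x y, Conn m n s t ↑T x y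

/-- The reduced vertex incidence matrix `𝕀` (the distinguished vertex is the last one). -/
def inc (R : Type*) [Ring R] (m n' : ℕ) (s t : Fin m → Fin (n' + 1)) :
    Matrix (Fin m) (Fin n') R :=
  Matrix.of fun e j =>
    (if t e = Fin.castSucc j then (1 : R) else 0) -
      (if s e = Fin.castSucc j then (1 : R) else 0)

/-- `C` is a cycle incidence matrix: its columns lie in, and form a `ℤ`-basis of,
the lattice `{x : ℤ^E | 𝕀ᵀ x = 0}`. -/
def IsCycleMatrix (m n' ℓ : ℕ) (s t : Fin m → Fin (n' + 1))
    (C : Matrix (Fin m) (Fin ℓ) ℤ) : Prop :=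
  (inc ℤ m n' s t)ᵀ * C = 0 ∧
    ∀ x : Fin m → ℤ, (inc ℤ m n' s t)ᵀ.mulVec x = 0 →
      ∃! c : Fin ℓ → ℤ, C.mulVec c = x

/-- The concatenation `[X|Y]` of the columns of `X` and of `Y`, a square matrix. -/
def concat {R : Type*} {m ℓ c : ℕ} (h : ℓ + c = m) (X : Matrix (Fin m) (Fin ℓ) R)
    (Y : Matrix (Fin m) (Fin c) R) : Matrix (Fin m) (Fin m) R :=
  Matrix.of fun i j => Sum.elim (X i) (Y i) (finSumFinEquiv.symm (Fin.cast h.symm j))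

/-- The row submatrix `X[S]` (rows of `S` taken in increasing order);
junk value `0` if `S.card ≠ k`. -/
noncomputable def rowSub {R : Type*} [Zero R] {m c : ℕ} (X : Matrix (Fin m) (Fin c) R)
    (S : Finset (Fin m)) (k : ℕ) : Matrix (Fin k) (Fin c) R :=
  if h : S.card = k then Matrix.of fun i j => X ((S.orderIsoOfFin h) i : Fin m) j else 0

/-- The expanded vertex Laplacian `𝕄`, rows/columns indexed by edges and then vertices. -/
def MM (m n' : ℕ) (s t : Fin m → Fin (n' + 1)) (a : Fin m → ℝ) :
    Matrix (Fin (m + n')) (Fin (m + n')) ℝ :=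
  Matrix.of fun i j =>
    Matrix.fromBlocks (Matrix.diagonal a) (inc ℝ m n' s t) (-(inc ℝ m n' s t)ᵀ) 0
      (finSumFinEquiv.symm i) (finSumFinEquiv.symm j)

/-- The Symanzik polynomial `ψ_G = det 𝕄`. -/
noncomputable def psi (m n' : ℕ) (s t : Fin m → Fin (n' + 1)) (a : Fin m → ℝ) : ℝ :=
  (MM m n' s t a).det

/-- The Dodgson polynomial `ψ^{A,B}`: delete the rows in `A` and the columns in `B`
from `𝕄` (keeping the induced order) and take the determinant. -/
noncomputable def dodgson (m n' : ℕ) (s t : Fin m → Fin (n' + 1)) (a : Fin m → ℝ)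
    (A B : Finset (Fin (m + n'))) : ℝ :=
  if h : A.card = B.card then
    Matrix.det (Matrix.of fun i j : Fin (m + n' - A.card) =>
      MM m n' s t a
        ((Aᶜ.orderIsoOfFin (by simp [Finset.card_compl]) i : Fin (m + n')))
        ((Bᶜ.orderIsoOfFin (by simp [Finset.card_compl, h]) j : Fin (m + n'))))
  else 0

/-- Index of the edge `i` among the rows/columns of `𝕄`. -/
def edgeIdx (m n' : ℕ) (i : Fin m) : Fin (m + n') := Fin.castAdd n' i

/-- Index of the vertex `j` among the rows/columns of `𝕄`. -/
def vtxIdx (m n' : ℕ) (j : Fin n') : Fin (m + n') := Fin.natAdd m j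

/-- The edge Dodgson polynomial `ψ^{e_i,e_j}`. -/
noncomputable def dodgE (m n' : ℕ) (s t : Fin m → Fin (n' + 1)) (a : Fin m → ℝ)
    (i j : Fin m) : ℝ :=
  dodgson m n' s t a {edgeIdx m n' i} {edgeIdx m n' j}

/-- The vertex Dodgson polynomial `ψ^{v_i,v_j}`. -/
noncomputable def dodgV (m n' : ℕ) (s t : Fin m → Fin (n' + 1)) (a : Fin m → ℝ)
    (i j : Fin n') : ℝ :=
  dodgson m n' s t a {vtxIdx m n' i} {vtxIdx m n' j}

/-- The vertex Laplacian `L = 𝕀ᵀ D⁻¹ 𝕀`. -/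
noncomputable def vertexLap (m n' : ℕ) (s t : Fin m → Fin (n' + 1)) (a : Fin m → ℝ) :
    Matrix (Fin n') (Fin n') ℝ :=
  (inc ℝ m n' s t)ᵀ * Matrix.diagonal (fun i => (a i)⁻¹) * inc ℝ m n' s t

/-- The cycle Laplacian `Λ = 𝒞ᵀ D 𝒞`. -/
def cycleLap {m ℓ : ℕ} (a : Fin m → ℝ) (C : Matrix (Fin m) (Fin ℓ) ℤ) :
    Matrix (Fin ℓ) (Fin ℓ) ℝ :=
  (C.map (Int.cast : ℤ → ℝ))ᵀ * Matrix.diagonal a * C.map (Int.cast : ℤ → ℝ)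

/-- The degree-one generators `θ_i` of the exterior algebra `Ω`. -/
noncomputable def θ (m : ℕ) (i : Fin m) : ExteriorAlgebra ℝ (Fin m → ℝ) :=
  ExteriorAlgebra.ι ℝ (Pi.single i 1)

/-- The Pfaffian of a `2k × 2k` matrix with entries in the exterior algebra. -/
noncomputable def pfaffian {m N k : ℕ} (hk : N = 2 * k)
    (X : Matrix (Fin N) (Fin N) (ExteriorAlgebra ℝ (Fin m → ℝ))) :
    ExteriorAlgebra ℝ (Fin m → ℝ) :=
  ((2 ^ k * (Nat.factorial k : ℝ))⁻¹) •
    ∑ σ : Equiv.Perm (Fin N), (((Equiv.Perm.sign σ : ℤ) : ℝ)) •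
      (List.ofFn fun i : Fin k =>
        X (σ (Fin.cast hk.symm ⟨2 * i.1, by have := i.2; omega⟩))
          (σ (Fin.cast hk.symm ⟨2 * i.1 + 1, by have := i.2; omega⟩))).prod

/-- `dΛ = 𝒞ᵀ Θ 𝒞`, with `Θ = diag(θ_1, ..., θ_m)`, in the exterior algebra. -/
noncomputable def dLam {m ℓ : ℕ} (C : Matrix (Fin m) (Fin ℓ) ℤ) :
    Matrix (Fin ℓ) (Fin ℓ) (ExteriorAlgebra ℝ (Fin m → ℝ)) :=
  (C.map fun z => algebraMap ℝ (ExteriorAlgebra ℝ (Fin m → ℝ)) (z : ℝ))ᵀ *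
    Matrix.diagonal (θ m) *
    C.map fun z => algebraMap ℝ (ExteriorAlgebra ℝ (Fin m → ℝ)) (z : ℝ)

/-- The Pfaffian form `φ_G = (−2π)^{−ℓ/2} Pf(dΛ Λ⁻¹ dΛ) / √ψ_G`. -/
noncomputable def phiForm (m n' ℓ k : ℕ) (hk : ℓ = 2 * k)
    (s t : Fin m → Fin (n' + 1)) (a : Fin m → ℝ) (C : Matrix (Fin m) (Fin ℓ) ℤ) :
    ExteriorAlgebra ℝ (Fin m → ℝ) :=
  ((((-2) * Real.pi) ^ k)⁻¹ * (Real.sqrt (psi m n' s t a))⁻¹) •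
    pfaffian hk
      (dLam C * ((cycleLap a C)⁻¹).map (algebraMap ℝ (ExteriorAlgebra ℝ (Fin m → ℝ))) *
        dLam C)

open Classical in
/-- Sum of `F T` over all spanning trees `T` of the graph. -/
noncomputable def treeSum {β : Type*} [AddCommMonoid β] (m n' : ℕ)
    (s t : Fin m → Fin (n' + 1)) (F : Finset (Fin m) → β) : β :=
  ∑ T ∈ Finset.univ.filter (fun T : Finset (Fin m) => IsSpanningTree m (n' + 1) s t T), F T

open Classical in
/-- The number of spanning trees of the graph. -/
noncomputable def treeCount (m n' : ℕ) (s t : Fin m → Fin (n' + 1)) : ℕ :=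
  (Finset.univ.filter (fun T : Finset (Fin m) => IsSpanningTree m (n' + 1) s t T)).card

/-- The summand of `α_G` corresponding to a spanning tree `T`. -/
noncomputable def alphaTerm {m n' ℓ k : ℕ} (hk : ℓ = 2 * k)
    (s t : Fin m → Fin (n' + 1)) (a : Fin m → ℝ) (T : Finset (Fin m)) :
    ExteriorAlgebra ℝ (Fin m → ℝ) :=
  if h : Tᶜ.card = ℓ then
    ((rowSub (inc ℝ m n' s t) T n').det *
        ∑ σ : Equiv.Perm (Fin ℓ), ∏ i : Fin k,
          dodgE m n' s t a
            ((Tᶜ.orderIsoOfFin h) (σ (Fin.cast hk.symm ⟨2 * i.1, by have := i.2; omega⟩)) : Fin m)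
            ((Tᶜ.orderIsoOfFin h) (σ (Fin.cast hk.symm ⟨2 * i.1 + 1, by have := i.2; omega⟩)) : Fin m)) •
      (List.ofFn fun j : Fin ℓ => θ m ((Tᶜ.orderIsoOfFin h) j : Fin m)).prod
  else 0

/-- The topological form `α_G`. -/
noncomputable def alphaForm (m n' ℓ k : ℕ) (hk : ℓ = 2 * k)
    (s t : Fin m → Fin (n' + 1)) (a : Fin m → ℝ) :
    ExteriorAlgebra ℝ (Fin m → ℝ) :=
  ((Real.pi ^ k * 4 ^ ℓ * (Nat.factorial k : ℝ) *
      psi m n' s t a ^ (((ℓ : ℝ) + 1) / 2))⁻¹) •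
    treeSum m n' s t (alphaTerm hk s t a)

/-- A walk in the graph, with signed edge traversals. -/
structure GWalk (m n : ℕ) (s t : Fin m → Fin n) (k : ℕ) where
  g : Fin k → Fin m
  ε : Fin k → ℤ
  u : Fin (k + 1) → Fin n
  hε : ∀ i, ε i = 1 ∨ ε i = -1
  hstep : ∀ i : Fin k,
    (ε i = 1 → s (g i) = u i.castSucc ∧ t (g i) = u i.succ) ∧
    (ε i = -1 → s (g i) = u i.succ ∧ t (g i) = u i.castSucc)

/-- The signed incidence vector of a walk. -/
def GWalk.vec {m n k : ℕ} {s t : Fin m → Fin n} (W : GWalk m n s t k) : Fin m → ℤ :=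
  fun e => ∑ i : Fin k, if W.g i = e then W.ε i else 0

/-- The lift of a vector along the subdivision of the edge `k` into two edges. -/
def liftVec {m : ℕ} (k : Fin m) (x : Fin m → ℤ) : Fin (m + 1) → ℤ :=
  fun i => if _ : i.1 ≤ k.1 then x ⟨i.1, by have := k.2; omega⟩
    else x ⟨i.1 - 1, by have := i.2; omega⟩



def evenIdx {k : ℕ} (i : Fin k) : Fin (2 * k) := ⟨2 * i.1, by have := i.2; omega⟩

def oddIdx {k : ℕ} (i : Fin k) : Fin (2 * k) := ⟨2 * i.1 + 1, by have := i.2; omega⟩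

theorem prod_ofFn_evenIdx_mul_oddIdx {R : Type*} [Monoid R] {k : ℕ} (F : Fin (2 * k) → R) :
    (List.ofFn fun i : Fin k => F (evenIdx i) * F (oddIdx i)).prod = (List.ofFn F).prod := by
  rw [List.ofFn_mul', List.prod_flatten, List.map_ofFn]
  congr 2
  funext i
  simp [List.ofFn_succ, evenIdx, oddIdx]

theorem prod_evenIdx_mul_oddIdx {R : Type*} [CommMonoid R] {k : ℕ} (F : Fin (2 * k) → R) :
    ∏ i : Fin k, F (evenIdx i) * F (oddIdx i) = ∏ j, F j := by
  rw [← List.prod_ofFn, ← List.prod_ofFn, prod_ofFn_evenIdx_mul_oddIdx]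

/-- A map out of `Fin (2 * k)` is a family of pairs indexed by `Fin k`. -/
def pairEquiv (k : ℕ) (α : Type*) : (Fin (2 * k) → α) ≃ (Fin k → α × α) where
  toFun g i := (g (evenIdx i), g (oddIdx i))
  invFun p j := if j.1 % 2 = 0 then (p ⟨j.1 / 2, by omega⟩).1 else (p ⟨j.1 / 2, by omega⟩).2
  left_inv g := by
    funext j
    dsimp only
    split_ifs with h
    · congr 1; ext; simp only [evenIdx]; omega
    · congr 1; ext; simp only [oddIdx]; omega
  right_inv p := by
    funext i
    have h : (2 * i.1 + 1) / 2 = i.1 := by omega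
    simp [evenIdx, oddIdx, Nat.add_mod, h]

theorem prod_ofFn_sum_smul {A : Type*} [Ring A] [Algebra ℝ A] {α : Type*} [Fintype α] {k : ℕ}
    (c : Fin k → α → ℝ) (x : Fin k → α → A) :
    (List.ofFn fun i : Fin k => ∑ p, c i p • x i p).prod =
      ∑ q : Fin k → α, (∏ i, c i (q i)) • (List.ofFn fun i => x i (q i)).prod := by
  classical
  have h := (MultilinearMap.mkPiAlgebraFin ℝ k A).map_sum (fun i p => c i p • x i p)
  simp only [MultilinearMap.mkPiAlgebraFin_apply] at h
  rw [h]
  refine Finset.sum_congr rfl fun q _ => ?_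
  have h2 := (MultilinearMap.mkPiAlgebraFin ℝ k A).map_smul_univ (fun i => c i (q i))
    (fun i => x i (q i))
  simpa only [MultilinearMap.mkPiAlgebraFin_apply] using h2

theorem pfaffian_expansion {m k : ℕ} (B : Matrix (Fin m) (Fin (2 * k)) ℝ)
    (K : Matrix (Fin m) (Fin m) ℝ) {A : Type*} [Ring A] [Algebra ℝ A] (θ : Fin m → A)
    (X : Matrix (Fin (2 * k)) (Fin (2 * k)) A)
    (hX : ∀ i j, X i j = ∑ p : Fin m × Fin m,
      (B p.1 i * B p.2 j * K p.1 p.2) • (θ p.1 * θ p.2)) :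
    (∑ σ : Equiv.Perm (Fin (2 * k)), (((Equiv.Perm.sign σ : ℤ) : ℝ)) •
      (List.ofFn fun i : Fin k => X (σ (evenIdx i)) (σ (oddIdx i))).prod) =
    ∑ g : Fin (2 * k) → Fin m,
      ((∏ i, K (g (evenIdx i)) (g (oddIdx i))) * (B.submatrix g id).det) •
        (List.ofFn fun j => θ (g j)).prod := by
  have h1 : ∀ σ : Equiv.Perm (Fin (2 * k)),
      (List.ofFn fun i : Fin k => X (σ (evenIdx i)) (σ (oddIdx i))).prod =
      ∑ g : Fin (2 * k) → Fin m, ((∏ i, K (g (evenIdx i)) (g (oddIdx i))) *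
        ∏ j, B (g j) (σ j)) • (List.ofFn fun j => θ (g j)).prod := by
    intro σ
    simp only [hX]
    rw [prod_ofFn_sum_smul, ← (pairEquiv k (Fin m)).sum_comp]
    refine Finset.sum_congr rfl fun g _ => ?_
    simp only [pairEquiv, Equiv.coe_fn_mk]
    rw [prod_ofFn_evenIdx_mul_oddIdx (fun j => θ (g j)), Finset.prod_mul_distrib,
      prod_evenIdx_mul_oddIdx (fun j => B (g j) (σ j)), mul_comm]
  simp only [h1, Finset.smul_sum, smul_smul]
  rw [Finset.sum_comm]
  refine Finset.sum_congr rfl fun g _ => ?_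
  rw [← Finset.sum_smul]
  congr 1
  rw [← det_transpose, det_apply, Finset.mul_sum]
  refine Finset.sum_congr rfl fun σ _ => ?_
  simp only [transpose_apply, submatrix_apply, id, Units.smul_def, zsmul_eq_mul]
  ring

theorem sum_eq_sum_orderEmbOfFin {m N : ℕ} {β : Type*} [AddCommMonoid β]
    (F : (Fin N → Fin m) → β) (hF : ∀ g, ¬ Function.Injective g → F g = 0) :
    ∑ g, F g = ∑ S : Finset (Fin m),
      if h : S.card = N then ∑ τ : Equiv.Perm (Fin N), F (S.orderEmbOfFin h ∘ τ) else 0 := by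
  classical
  rw [← Finset.sum_fiberwise (s := Finset.univ) (g := fun g : Fin N → Fin m =>
    Finset.univ.image g)]
  refine Finset.sum_congr rfl fun S _ => ?_
  split_ifs with h
  · symm
    refine Finset.sum_bij (fun τ _ => S.orderEmbOfFin h ∘ τ) ?_ ?_ ?_ ?_
    · intro τ _
      simp only [Finset.mem_filter, Finset.mem_univ, true_and]
      apply Finset.coe_injective
      rw [Finset.coe_image, Finset.coe_univ, Set.image_univ, Set.range_comp,
        τ.surjective.range_eq, Set.image_univ, Finset.range_orderEmbOfFin]
    · intro τ _ τ' _ heq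
      ext i
      have := congrFun heq i
      exact congrArg Fin.val ((S.orderEmbOfFin h).injective this)
    · intro g hg
      simp only [Finset.mem_filter, Finset.mem_univ, true_and] at hg
      have hmem : ∀ i, g i ∈ S := fun i => by
        rw [← hg]; exact Finset.mem_image_of_mem _ (Finset.mem_univ i)
      have hinj : Function.Injective g := by
        rw [← Set.injOn_univ, ← Finset.coe_univ, ← Finset.card_image_iff, hg, h]
        simp
      let τ : Fin N → Fin N := fun i => (S.orderIsoOfFin h).symm ⟨g i, hmem i⟩
      have hτ : Function.Injective τ := fun i j hij => by
        have := (S.orderIsoOfFin h).symm.injective hij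
        exact hinj (congrArg Subtype.val this)
      refine ⟨Equiv.ofBijective τ (Finite.injective_iff_bijective.mp hτ), Finset.mem_univ _, ?_⟩
      funext i
      simp [τ, ← Finset.coe_orderIsoOfFin_apply]
    · intros; rfl
  · refine Finset.sum_eq_zero fun g hg => hF g fun hinj => h ?_
    simp only [Finset.mem_filter, Finset.mem_univ, true_and] at hg
    rw [← hg, Finset.card_image_of_injective _ hinj]
    simp

theorem sign_finSumEquivOfFinset {p q : ℕ} (S : Finset (Fin (p + q))) (hp : S.card = p)
    (hq : Sᶜ.card = q) :
    ((Equiv.Perm.sign (finSumFinEquiv.symm.trans (finSumEquivOfFinset hp hq))  : ℤˣ) : ℤ) =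
      ∏ i : Fin p, (-1) ^ ((S.orderEmbOfFin hp i : ℕ) + i) := by
  classical
  set σ := finSumFinEquiv.symm.trans (finSumEquivOfFinset hp hq) with hσ
  have hl : ∀ i : Fin p, σ (Fin.castAdd q i) = S.orderEmbOfFin hp i := by simp [hσ]
  have hr : ∀ i : Fin q, σ (Fin.natAdd p i) = Sᶜ.orderEmbOfFin hq i := by simp [hσ]
  have key : ∀ i : Fin (p + q), (∏ j ∈ Finset.Ioi i, if σ i < σ j then (1 : ℤ) else -1) =
      ∏ j, if i < j then (if σ i < σ j then (1 : ℤ) else -1) else 1 := by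
    intro i
    rw [← Finset.prod_filter]
    congr 1
    ext; simp
  rw [Equiv.Perm.sign_eq_prod_prod_Ioi]
  push_cast
  simp only [apply_ite, Units.val_one, Units.val_neg, key]
  rw [Fin.prod_univ_add]
  have h2 : ∀ i : Fin q, (∏ j, if Fin.natAdd p i < j then
      (if σ (Fin.natAdd p i) < σ j then (1 : ℤ) else -1) else 1) = 1 := by
    intro i
    refine Finset.prod_eq_one fun j _ => ?_
    refine Fin.addCases (fun j => ?_) (fun j => ?_) j
    · rw [if_neg]; simp [Fin.lt_def]; omega
    · split_ifs with h h' <;> try rfl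
      rw [hr, hr, OrderEmbedding.lt_iff_lt] at h'
      exact (h' (by simpa using h)).elim
  simp only [h2, Finset.prod_const_one, mul_one]
  refine Finset.prod_congr rfl fun i _ => ?_
  rw [Fin.prod_univ_add]
  have h3 : (∏ j : Fin p, if Fin.castAdd q i < Fin.castAdd q j then
      (if σ (Fin.castAdd q i) < σ (Fin.castAdd q j) then (1 : ℤ) else -1) else 1) = 1 := by
    refine Finset.prod_eq_one fun j _ => ?_
    split_ifs with h h' <;> try rfl
    rw [hl, hl, OrderEmbedding.lt_iff_lt] at h'
    exact (h' h).elim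
  rw [h3, one_mul]
  set x := S.orderEmbOfFin hp i with hx
  have h4 : (∏ j : Fin q, if Fin.castAdd q i < Fin.natAdd p j then
      (if σ (Fin.castAdd q i) < σ (Fin.natAdd p j) then (1 : ℤ) else -1) else 1) =
      (-1) ^ (Finset.univ.filter fun j : Fin q => Sᶜ.orderEmbOfFin hq j < x).card := by
    rw [← Finset.prod_const, Finset.prod_filter]
    refine Finset.prod_congr rfl fun j _ => ?_
    have hne : x ≠ Sᶜ.orderEmbOfFin hq j := fun h => by
      have h5 := Finset.orderEmbOfFin_mem Sᶜ hq j
      rw [← h, Finset.mem_compl] at h5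
      exact h5 (Finset.orderEmbOfFin_mem S hp i)
    rw [if_pos (by simp [Fin.lt_def]; omega), hl, hr]
    rcases lt_or_gt_of_ne hne with h | h
    · rw [if_pos h, if_neg h.not_gt]
    · rw [if_neg h.not_gt, if_pos h]
  have h6 : (Finset.univ.filter fun j : Fin q => Sᶜ.orderEmbOfFin hq j < x).card =
      (Finset.univ.filter fun y : Fin (p + q) => y ∈ Sᶜ ∧ y < x).card := by
    rw [← Finset.card_map (Sᶜ.orderEmbOfFin hq).toEmbedding]
    congr 1
    ext y
    simp only [Finset.mem_map, Finset.mem_filter, Finset.mem_univ, true_and]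
    constructor
    · rintro ⟨j, hj, rfl⟩
      exact ⟨Finset.orderEmbOfFin_mem Sᶜ hq j, hj⟩
    · rintro ⟨hy, hyx⟩
      have : y ∈ Set.range (Sᶜ.orderEmbOfFin hq) := by
        rw [Finset.range_orderEmbOfFin]; exact hy
      obtain ⟨j, rfl⟩ := this
      exact ⟨j, hyx, rfl⟩
  have h7 : (i : ℕ) = (Finset.univ.filter fun y : Fin (p + q) => y ∈ S ∧ y < x).card := by
    rw [← Fin.card_Iio i, ← Finset.card_map (S.orderEmbOfFin hp).toEmbedding]
    congr 1
    ext y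
    simp only [Finset.mem_map, Finset.mem_filter, Finset.mem_univ, true_and, Finset.mem_Iio]
    constructor
    · rintro ⟨j, hj, rfl⟩
      exact ⟨Finset.orderEmbOfFin_mem S hp j, by simpa [hx] using hj⟩
    · rintro ⟨hy, hyx⟩
      have : y ∈ Set.range (S.orderEmbOfFin hp) := by
        rw [Finset.range_orderEmbOfFin]; exact hy
      obtain ⟨j, rfl⟩ := this
      exact ⟨j, by simpa [hx] using hyx, rfl⟩
  have h8 : (x : ℕ) = (Finset.univ.filter fun y : Fin (p + q) => y ∈ S ∧ y < x).card +
      (Finset.univ.filter fun y : Fin (p + q) => y ∈ Sᶜ ∧ y < x).card := by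
    conv_lhs => rw [← Fin.card_Iio x]
    rw [← Finset.card_filter_add_card_filter_not (s := Finset.Iio x) (p := fun y => y ∈ S)]
    congr 2 <;> ext y <;> simp [and_comm]
  rw [h4, h6, h8, ← h7, show ∀ c : ℕ, (i : ℕ) + c + i = c + 2 * i from fun c => by ring,
    pow_add, pow_mul]
  simp

theorem prod_neg_one_pow_val (k : ℕ) : ∏ i : Fin (2 * k), (-1 : ℤ) ^ (i : ℕ) = (-1) ^ k := by
  rw [← prod_evenIdx_mul_oddIdx]
  simp [evenIdx, oddIdx, pow_add, pow_mul]

theorem det_rowMinor {p q : ℕ} {R : Type*} [CommRing R]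
    (C : Matrix (Fin (p + q)) (Fin p) R)
    (P I : Matrix (Fin (p + q)) (Fin q) R) (hC : Iᵀ * C = 0) (hP : Iᵀ * P = 1)
    (e : Fin p ⊕ Fin q ≃ Fin (p + q)) :
    (I.submatrix (e ∘ Sum.inr) id).det *
      (((Equiv.Perm.sign (finSumFinEquiv.symm.trans e) : ℤˣ) : ℤ) *
        ((fromCols C P).submatrix id finSumFinEquiv.symm).det) =
      (C.submatrix (e ∘ Sum.inl) id).det := by
  have hQ : ((fromCols C P).submatrix e id).det =
      (((Equiv.Perm.sign (finSumFinEquiv.symm.trans e) : ℤˣ) : ℤ) *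
        ((fromCols C P).submatrix id finSumFinEquiv.symm).det) := by
    rw [← det_permute, ← det_submatrix_equiv_self finSumFinEquiv.symm]
    rfl
  rw [← hQ]
  let Z : Matrix (Fin p ⊕ Fin q) (Fin p ⊕ Fin q) R :=
    fromBlocks 1 0 (I.submatrix (e ∘ Sum.inl) id)ᵀ (I.submatrix (e ∘ Sum.inr) id)ᵀ
  have hZ : Z * (fromCols C P).submatrix e id =
      fromBlocks (C.submatrix (e ∘ Sum.inl) id) (P.submatrix (e ∘ Sum.inl) id) 0 1 := by
    have hb : (fromCols C P).submatrix e id = fromBlocks (C.submatrix (e ∘ Sum.inl) id)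
        (P.submatrix (e ∘ Sum.inl) id) (C.submatrix (e ∘ Sum.inr) id)
        (P.submatrix (e ∘ Sum.inr) id) := by
      ext i j
      rcases i with i | i <;> rcases j with j | j <;> rfl
    have split : ∀ {r : ℕ} (Y : Matrix (Fin (p + q)) (Fin r) R),
        (I.submatrix (e ∘ Sum.inl) id)ᵀ * Y.submatrix (e ∘ Sum.inl) id +
        (I.submatrix (e ∘ Sum.inr) id)ᵀ * Y.submatrix (e ∘ Sum.inr) id = Iᵀ * Y := by
      intro r Y
      ext i j
      simp only [Matrix.add_apply, mul_apply, transpose_apply, submatrix_apply, id, Function.comp]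
      rw [← e.sum_comp, Fintype.sum_sum_type]
    rw [hb, fromBlocks_multiply, split, split, hC, hP]
    simp
  have := congrArg det hZ
  rwa [det_mul, det_fromBlocks_zero₁₂, det_fromBlocks_zero₂₁, det_one, det_one, one_mul, mul_one,
    det_transpose] at this

theorem posDef_transpose_mul_diagonal_mul {m r : ℕ} (d : Fin m → ℝ) (hd : ∀ i, 0 < d i)
    (B : Matrix (Fin m) (Fin r) ℝ) (A : Matrix (Fin r) (Fin m) ℝ) (hA : A * B = 1) :
    (Bᵀ * diagonal d * B).PosDef := by
  have h : Function.Injective B.mulVec := fun x y hxy => by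
    have := congrArg A.mulVec hxy
    simpa [hA] using this
  simpa using (PosDef.diagonal hd).conjTranspose_mul_mul_same h

theorem det_submatrix_compl_singleton {N : ℕ} (M : Matrix (Fin N) (Fin N) ℝ) (i j : Fin N)
    (hi : ({i}ᶜ : Finset (Fin N)).card = N - ({i} : Finset (Fin N)).card)
    (hj : ({j}ᶜ : Finset (Fin N)).card = N - ({i} : Finset (Fin N)).card) :
    det (of fun p q : Fin (N - ({i} : Finset (Fin N)).card) =>
      M (({i}ᶜ : Finset (Fin N)).orderIsoOfFin hi p) (({j}ᶜ : Finset (Fin N)).orderIsoOfFin hj q)) =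
      (-1) ^ (i + j : ℕ) * M.adjugate j i := by
  obtain _ | N := N
  · exact i.elim0
  · rw [adjugate_fin_succ_eq_det_submatrix, ← mul_assoc, ← pow_add, ← two_mul, pow_mul]
    simp only [even_two, Even.neg_pow, one_pow, one_mul]
    have e : ∀ (l : Fin (N + 1)) (hl : ({l}ᶜ : Finset (Fin (N + 1))).card = N) (p : Fin N),
        ((({l}ᶜ : Finset (Fin (N + 1))).orderIsoOfFin hl p : _) : Fin (N + 1)) =
          l.succAbove p := by
      intro l hl p
      rw [Finset.coe_orderIsoOfFin_apply, Finset.orderEmbOfFin_compl_singleton]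
      rfl
    change det (of fun p q : Fin N => _) = _
    congr 1
    ext p q
    rw [of_apply, submatrix_apply]
    congr 1
    · exact e i hi p
    · exact e j hj q

theorem exists_cycle_section {m n' ℓ : ℕ} {s t : Fin m → Fin (n' + 1)}
    {C : Matrix (Fin m) (Fin ℓ) ℤ} (hC : IsCycleMatrix m n' ℓ s t C)
    {P : Matrix (Fin m) (Fin n') ℤ} (hP : (inc ℤ m n' s t)ᵀ * P = 1) :
    ∃ A : Matrix (Fin ℓ) (Fin m) ℤ, C * A + P * (inc ℤ m n' s t)ᵀ = 1 ∧ A * C = 1 := by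
  set I := inc ℤ m n' s t
  have h0 : Iᵀ * (1 - P * Iᵀ) = 0 := by
    rw [Matrix.mul_sub, ← Matrix.mul_assoc, hP]; simp
  have h : ∀ e, ∃ c, C.mulVec c = fun i => (1 - P * Iᵀ : Matrix (Fin m) (Fin m) ℤ) i e := fun e => by
    refine (hC.2 _ ?_).exists
    funext i
    exact congrFun (congrFun h0 i) e
  choose c hc using h
  have hA : C * (of fun i e => c e i) = 1 - P * Iᵀ := by
    ext i e
    exact congrFun (hc e) i
  refine ⟨of fun i e => c e i, by rw [hA]; simp, ?_⟩
  have hCA : C * ((of fun i e => c e i) * C) = C * (1 : Matrix (Fin ℓ) (Fin ℓ) ℤ) := by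
    rw [← Matrix.mul_assoc, hA, Matrix.sub_mul, Matrix.mul_assoc, hC.1]; simp
  ext i j
  have hj : C.mulVec (((of fun i e => c e i) * C).mulVec (Pi.single j 1)) =
      C.mulVec (Pi.single j 1) := by
    rw [mulVec_mulVec, hCA, Matrix.mul_one]
  obtain ⟨_, _, hu⟩ := hC.2 (C.mulVec (Pi.single j 1)) (by
    rw [mulVec_mulVec, hC.1, zero_mulVec])
  have h1 := (hu _ hj).trans (hu (Pi.single j 1) rfl).symm
  have h2 := congrFun h1 i
  simpa [mulVec_mulVec, Matrix.one_apply, Pi.single_apply] using h2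

theorem det_concat_eq_one_or_neg_one {p q : ℕ} (C : Matrix (Fin (p + q)) (Fin p) ℤ)
    (P : Matrix (Fin (p + q)) (Fin q) ℤ) (A : Matrix (Fin p) (Fin (p + q)) ℤ)
    (J : Matrix (Fin q) (Fin (p + q)) ℤ) (h : C * A + P * J = 1) :
    ((fromCols C P).submatrix id finSumFinEquiv.symm).det = 1 ∨
      ((fromCols C P).submatrix id finSumFinEquiv.symm).det = -1 := by
  rw [← Int.isUnit_iff]
  refine IsUnit.of_mul_eq_one
    ((fromRows A J).submatrix (finSumFinEquiv (m := p) (n := q)).symm id).det ?_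
  rw [← det_mul, submatrix_mul_equiv, fromCols_mul_fromRows, h]
  simp

theorem inc_map (m n' : ℕ) (s t : Fin m → Fin (n' + 1)) :
    (inc ℤ m n' s t).map (Int.cast : ℤ → ℝ) = inc ℝ m n' s t := by
  ext i j
  simp [inc]

theorem psi_pos {m n' : ℕ} (s t : Fin m → Fin (n' + 1)) (a : Fin m → ℝ) (ha : ∀ i, 0 < a i)
    (P : Matrix (Fin m) (Fin n') ℝ) (hP : Pᵀ * inc ℝ m n' s t = 1) : 0 < psi m n' s t a := by
  have hD : IsUnit (diagonal a).det := by
    rw [det_diagonal]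
    exact (Finset.prod_ne_zero_iff.2 fun i _ => (ha i).ne').isUnit
  let _ := invertibleOfIsUnitDet _ hD
  have hpos := posDef_transpose_mul_diagonal_mul (fun i => (a i)⁻¹) (fun i => inv_pos.2 (ha i))
    _ _ hP
  have hinv : (diagonal a)⁻¹ = diagonal fun i => (a i)⁻¹ := by
    refine inv_eq_right_inv ?_
    rw [diagonal_mul_diagonal, ← diagonal_one]
    congr 1
    funext i
    exact mul_inv_cancel₀ (ha i).ne'
  have : psi m n' s t a = (∏ i, a i) *
      ((inc ℝ m n' s t)ᵀ * diagonal (fun i => (a i)⁻¹) * inc ℝ m n' s t).det := by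
    have h1 : psi m n' s t a = (fromBlocks (diagonal a) (inc ℝ m n' s t)
        (-(inc ℝ m n' s t)ᵀ) 0).det :=
      det_submatrix_equiv_self finSumFinEquiv.symm _
    rw [h1, det_fromBlocks₁₁, det_diagonal, invOf_eq_nonsing_inv, hinv]
    simp
  rw [this]
  exact mul_pos (Finset.prod_pos fun i _ => ha i) hpos.det_pos

/-- The edge block of `𝕄⁻¹` is `𝒞 Λ⁻¹ 𝒞ᵀ`. -/
theorem inv_toBlocks₁₁ {m q ℓ : ℕ} (D : Matrix (Fin m) (Fin m) ℝ)
    (I P : Matrix (Fin m) (Fin q) ℝ) (C : Matrix (Fin m) (Fin ℓ) ℝ)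
    (A : Matrix (Fin ℓ) (Fin m) ℝ) (hIC : Iᵀ * C = 0) (hA : C * A + P * Iᵀ = 1)
    (hL : IsUnit (Cᵀ * D * C).det) (hM : IsUnit (fromBlocks D I (-Iᵀ) 0).det) :
    ((fromBlocks D I (-Iᵀ) 0)⁻¹).toBlocks₁₁ = C * (Cᵀ * D * C)⁻¹ * Cᵀ := by
  have h := mul_nonsing_inv _ hM
  set N := (fromBlocks D I (-Iᵀ) 0)⁻¹
  rw [← fromBlocks_toBlocks N, fromBlocks_multiply, ← fromBlocks_one, fromBlocks_inj] at h
  obtain ⟨h1, -, h2, -⟩ := h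
  have h2' : Iᵀ * N.toBlocks₁₁ = 0 := by simpa using h2
  have h3 : N.toBlocks₁₁ = C * (A * N.toBlocks₁₁) := by
    calc N.toBlocks₁₁ = (C * A + P * Iᵀ) * N.toBlocks₁₁ := by rw [hA, Matrix.one_mul]
      _ = _ := by rw [Matrix.add_mul, Matrix.mul_assoc, Matrix.mul_assoc P, h2']; simp
  have hCI : Cᵀ * I = 0 := by
    have := congrArg transpose hIC
    simpa using this
  have h4 : (Cᵀ * D * C) * (A * N.toBlocks₁₁) = Cᵀ := by
    rw [Matrix.mul_assoc, ← h3, Matrix.mul_assoc, eq_sub_of_add_eq h1, Matrix.mul_sub,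
      ← Matrix.mul_assoc, hCI]
    simp
  have h5 : A * N.toBlocks₁₁ = (Cᵀ * D * C)⁻¹ * Cᵀ := by
    rw [← nonsing_inv_mul_cancel_left _ (A * N.toBlocks₁₁) hL, h4]
  rw [Matrix.mul_assoc, ← h5]
  exact h3

theorem dodgE_eq {m n' : ℕ} (s t : Fin m → Fin (n' + 1)) (a : Fin m → ℝ)
    (hpsi : psi m n' s t a ≠ 0) (i j : Fin m) :
    dodgE m n' s t a i j = (-1) ^ (i + j : ℕ) * (psi m n' s t a *
      ((fromBlocks (diagonal a) (inc ℝ m n' s t) (-(inc ℝ m n' s t)ᵀ) 0)⁻¹).toBlocks₁₁ j i) := by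
  have hpsi' : psi m n' s t a = (fromBlocks (diagonal a) (inc ℝ m n' s t)
      (-(inc ℝ m n' s t)ᵀ) 0).det := det_submatrix_equiv_self finSumFinEquiv.symm _
  have hMM : MM m n' s t a = (fromBlocks (diagonal a) (inc ℝ m n' s t)
      (-(inc ℝ m n' s t)ᵀ) 0).submatrix finSumFinEquiv.symm finSumFinEquiv.symm := rfl
  rw [dodgE, dodgson, dif_pos (by simp), det_submatrix_compl_singleton, hMM,
    adjugate_submatrix_equiv_self, hpsi', inv_def, Ring.inverse_eq_inv']
  rw [hpsi'] at hpsi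
  simp [edgeIdx, toBlocks₁₁, mul_inv_cancel_left₀ hpsi]

theorem conn_symm {m n : ℕ} {s t : Fin m → Fin n} {T : Set (Fin m)} {x y : Fin n}
    (h : Conn m n s t T x y) : Conn m n s t T y x := by
  have : Std.Symm fun a b => ∃ e ∈ T, (s e = a ∧ t e = b) ∨ (s e = b ∧ t e = a) :=
    ⟨fun _ _ ⟨e, he, h⟩ => ⟨e, he, h.symm⟩⟩
  exact Relation.ReflTransGen.stdSymm.symm _ _ h

theorem det_rowSub_inc_eq_zero {m n' : ℕ} {s t : Fin m → Fin (n' + 1)} {T : Finset (Fin m)}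
    (hT : T.card = n') (h : ¬ IsSpanningTree m (n' + 1) s t T) :
    (rowSub (inc ℝ m n' s t) T n').det = 0 := by
  classical
  have h1 : ∃ x, ¬ Conn m (n' + 1) s t ↑T x (Fin.last n') := by
    by_contra hcon
    push Not at hcon
    exact h ⟨by simpa using hT, fun x y => (hcon x).trans (conn_symm (hcon y))⟩
  obtain ⟨x, hx⟩ := h1
  let f : Fin (n' + 1) → ℝ := fun y => if Conn m (n' + 1) s t ↑T y (Fin.last n') then 0 else 1
  have hlast : f (Fin.last n') = 0 := if_pos Relation.ReflTransGen.refl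
  have hx' : x ≠ Fin.last n' := by
    rintro rfl
    exact hx Relation.ReflTransGen.refl
  have hsum : ∀ y : Fin (n' + 1),
      ∑ j : Fin n', (if y = Fin.castSucc j then (1 : ℝ) else 0) * f (Fin.castSucc j) = f y := by
    intro y
    have := Fin.sum_univ_castSucc fun j => (if y = j then (1 : ℝ) else 0) * f j
    rw [hlast, mul_zero, add_zero] at this
    rw [← this]
    simp
  rw [← exists_mulVec_eq_zero_iff]
  refine ⟨fun j => f (Fin.castSucc j), fun h0 => ?_, ?_⟩
  · have := congrFun h0 (x.castPred hx')
    simp [f, hx] at this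
  · funext i
    rw [rowSub, dif_pos hT]
    simp only [mulVec, dotProduct, of_apply, inc, sub_mul, Finset.sum_sub_distrib, hsum,
      Pi.zero_apply]
    set e := T.orderIsoOfFin hT i with he
    have hstep : Conn m (n' + 1) s t ↑T (s e) (t e) :=
      Relation.ReflTransGen.single ⟨e, e.2, Or.inl ⟨rfl, rfl⟩⟩
    have hiff : Conn m (n' + 1) s t ↑T (t e) (Fin.last n') ↔
        Conn m (n' + 1) s t ↑T (s e) (Fin.last n') :=
      ⟨fun h => hstep.trans h, fun h => (conn_symm hstep).trans h⟩
    simp [f, hiff]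

theorem dLam_apply {m ℓ : ℕ} (C : Matrix (Fin m) (Fin ℓ) ℤ) (i j : Fin ℓ) :
    dLam C i j = ∑ e, ((C e i : ℝ) * (C e j : ℝ)) • θ m e := by
  rw [dLam, mul_apply]
  simp only [mul_diagonal, transpose_apply, map_apply]
  refine Finset.sum_congr rfl fun e _ => ?_
  rw [← Algebra.commutes, ← Algebra.smul_def, ← Algebra.smul_def, smul_smul, mul_comm]

theorem dLam_mul_mul_dLam_apply {m ℓ : ℕ} (C : Matrix (Fin m) (Fin ℓ) ℤ)
    (L : Matrix (Fin ℓ) (Fin ℓ) ℝ) (i j : Fin ℓ) :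
    (dLam C * L.map (algebraMap ℝ (ExteriorAlgebra ℝ (Fin m → ℝ))) * dLam C) i j =
      ∑ p : Fin m × Fin m,
        (C.map (Int.cast : ℤ → ℝ) p.1 i * C.map (Int.cast : ℤ → ℝ) p.2 j *
          (C.map (Int.cast : ℤ → ℝ) * L * (C.map (Int.cast : ℤ → ℝ))ᵀ) p.1 p.2) •
        (θ m p.1 * θ m p.2) := by
  simp only [mul_apply, dLam_apply, map_apply, transpose_apply, Finset.sum_mul, Finset.mul_sum,
    Finset.sum_smul, Fintype.sum_prod_type]
  have h : ∀ q : Fin ℓ, ∀ p : Fin ℓ, ∀ e f : Fin m,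
      (((C e i : ℝ) * (C e p : ℝ)) • θ m e * algebraMap ℝ _ (L p q)) *
        (((C f q : ℝ) * (C f j : ℝ)) • θ m f) =
      ((C e i : ℝ) * (C f j : ℝ) * ((C e p : ℝ) * L p q * (C f q : ℝ))) • (θ m e * θ m f) := by
    intro q p e f
    rw [← Algebra.commutes, ← Algebra.smul_def, smul_smul, smul_mul_smul_comm]
    congr 1
    ring
  simp only [h]
  calc _ = ∑ q : Fin ℓ, ∑ f : Fin m, ∑ e : Fin m, ∑ p : Fin ℓ, _ :=
        Finset.sum_congr rfl fun q _ => Finset.sum_congr rfl fun f _ => Finset.sum_comm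
    _ = ∑ f : Fin m, ∑ q : Fin ℓ, ∑ e : Fin m, ∑ p : Fin ℓ, _ := Finset.sum_comm
    _ = ∑ f : Fin m, ∑ e : Fin m, ∑ q : Fin ℓ, ∑ p : Fin ℓ, _ :=
        Finset.sum_congr rfl fun f _ => Finset.sum_comm
    _ = _ := Finset.sum_comm

theorem prod_ofFn_θ_eq_zero {m N : ℕ} (g : Fin N → Fin m) (hg : ¬ Function.Injective g) :
    (List.ofFn fun j => θ m (g j)).prod = 0 := by
  have := (ExteriorAlgebra.ιMulti ℝ N).map_eq_zero_of_not_injective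
    (fun j => (Pi.single (g j) 1 : Fin m → ℝ)) (fun h => hg fun i j hij => h (by simp [hij]))
  rwa [ExteriorAlgebra.ιMulti_apply] at this

theorem prod_ofFn_θ_perm {m N : ℕ} (g : Fin N → Fin m) (τ : Equiv.Perm (Fin N)) :
    (List.ofFn fun j => θ m (g (τ j))).prod =
      ((Equiv.Perm.sign τ : ℤ) : ℝ) • (List.ofFn fun j => θ m (g j)).prod := by
  have := (ExteriorAlgebra.ιMulti ℝ N).map_perm (fun j => (Pi.single (g j) 1 : Fin m → ℝ)) τ
  rw [ExteriorAlgebra.ιMulti_apply, ExteriorAlgebra.ιMulti_apply] at this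
  rw [Units.smul_def, ← Int.cast_smul_eq_zsmul ℝ] at this
  exact this

theorem pfaffian_sum_eq {m k : ℕ} (B : Matrix (Fin m) (Fin (2 * k)) ℝ)
    (K : Matrix (Fin m) (Fin m) ℝ) :
    (∑ g : Fin (2 * k) → Fin m,
      ((∏ i, K (g (evenIdx i)) (g (oddIdx i))) * (B.submatrix g id).det) •
        (List.ofFn fun j => θ m (g j)).prod) =
    ∑ S : Finset (Fin m), if h : S.card = 2 * k then
      ((B.submatrix (S.orderEmbOfFin h) id).det * ∑ τ : Equiv.Perm (Fin (2 * k)), ∏ i,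
        K (S.orderEmbOfFin h (τ (evenIdx i))) (S.orderEmbOfFin h (τ (oddIdx i)))) •
      (List.ofFn fun j => θ m (S.orderEmbOfFin h j)).prod else 0 := by
  rw [sum_eq_sum_orderEmbOfFin]
  · refine Finset.sum_congr rfl fun S _ => ?_
    split_ifs with h
    · rw [Finset.mul_sum, Finset.sum_smul]
      refine Finset.sum_congr rfl fun τ _ => ?_
      have hdet : (B.submatrix (S.orderEmbOfFin h ∘ τ) id).det =
          ((Equiv.Perm.sign τ : ℤ) : ℝ) * (B.submatrix (S.orderEmbOfFin h) id).det := by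
        rw [← det_permute]
        rfl
      have hs : ((Equiv.Perm.sign τ : ℤ) : ℝ) * ((Equiv.Perm.sign τ : ℤ) : ℝ) = 1 := by
        rw [← Int.cast_mul, Int.units_coe_mul_self, Int.cast_one]
      simp only [Function.comp_apply]
      rw [prod_ofFn_θ_perm, hdet, smul_smul]
      congr 1
      linear_combination (∏ i, K (S.orderEmbOfFin h (τ (evenIdx i)))
        (S.orderEmbOfFin h (τ (oddIdx i)))) * (B.submatrix (S.orderEmbOfFin h) id).det * hs
    · rfl
  · intro g hg
    rw [prod_ofFn_θ_eq_zero g hg, smul_zero]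

theorem treeSum_alphaTerm {m n' ℓ k : ℕ} (hm : ℓ + n' = m) (hk : ℓ = 2 * k)
    (s t : Fin m → Fin (n' + 1)) (a : Fin m → ℝ) :
    treeSum m n' s t (alphaTerm hk s t a) = ∑ T : Finset (Fin m), alphaTerm hk s t a T := by
  classical
  rw [treeSum]
  refine (Finset.sum_filter_of_ne fun T _ hT => ?_)
  by_contra h
  refine hT ?_
  rw [alphaTerm]
  split_ifs with hc
  · have hcard : T.card = n' := by
      rw [Finset.card_compl, Fintype.card_fin] at hc
      have := Finset.card_le_univ T
      rw [Fintype.card_fin] at this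
      omega
    rw [det_rowSub_inc_eq_zero hcard h, zero_mul, zero_smul]
  · rfl

/-- **Main Theorem.** For a connected graph with even loop number,
`α_G = (det[𝒞|𝒫] / 2^ℓ) • φ_G`, and `det[𝒞|𝒫] ∈ {+1, −1}`. -/
theorem main_theorem (m n' ℓ k : ℕ) (s t : Fin m → Fin (n' + 1))
    (hconn : IsConnectedGraph m (n' + 1) s t)
    (hm : ℓ + n' = m) (hk : ℓ = 2 * k)
    (a : Fin m → ℝ) (ha : ∀ i, 0 < a i)
    (C : Matrix (Fin m) (Fin ℓ) ℤ) (hC : IsCycleMatrix m n' ℓ s t C)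
    (P : Matrix (Fin m) (Fin n') ℤ) (hP : Pᵀ * inc ℤ m n' s t = 1) :
    alphaForm m n' ℓ k hk s t a =
      ((((concat hm C P).det : ℝ) / 2 ^ ℓ) • phiForm m n' ℓ k hk s t a C) ∧
    ((concat hm C P).det = 1 ∨ (concat hm C P).det = -1) := by
  subst hk
  subst hm
  set I := inc ℤ (2 * k + n') n' s t with hI
  have hIP : Iᵀ * P = 1 := by simpa using congrArg transpose hP
  obtain ⟨A, hA, hAC⟩ := exists_cycle_section hC hIP
  have hQ : concat rfl C P = (fromCols C P).submatrix id finSumFinEquiv.symm := by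
    ext i j
    simp only [concat, of_apply, submatrix_apply, Fin.cast_eq_self, id]
    rcases finSumFinEquiv.symm j <;> rfl
  rw [← hI] at hA
  have hdet := det_concat_eq_one_or_neg_one C P A Iᵀ hA
  rw [hQ]
  refine ⟨?_, hdet⟩
  set q := ((fromCols C P).submatrix id finSumFinEquiv.symm).det with hq
  have hqq : (q : ℝ) * q = 1 := by
    rcases hdet with h | h <;> simp [h]
  set C' := C.map (Int.cast : ℤ → ℝ) with hC'
  set I' := inc ℝ (2 * k + n') n' s t with hI'
  have hII : I.map (Int.cast : ℤ → ℝ) = I' := inc_map _ _ _ _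
  set P' := P.map (Int.cast : ℤ → ℝ)
  set A' := A.map (Int.cast : ℤ → ℝ)
  have mapMul : ∀ {x y z : ℕ} (X : Matrix (Fin x) (Fin y) ℤ) (Y : Matrix (Fin y) (Fin z) ℤ),
      (X * Y).map (Int.cast : ℤ → ℝ) = X.map (Int.cast : ℤ → ℝ) * Y.map (Int.cast : ℤ → ℝ) :=
    fun X Y => Matrix.map_mul (f := Int.castRingHom ℝ)
  have mapOne : ∀ x : ℕ, (1 : Matrix (Fin x) (Fin x) ℤ).map (Int.cast : ℤ → ℝ) = 1 :=
    fun x => Matrix.map_one _ Int.cast_zero Int.cast_one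
  have hIC' : I'ᵀ * C' = 0 := by
    rw [← hII, ← transpose_map, ← mapMul, hC.1]; ext; simp
  have hIP' : I'ᵀ * P' = 1 := by rw [← hII, ← transpose_map, ← mapMul, hIP, mapOne]
  have hPI' : P'ᵀ * I' = 1 := by simpa using congrArg transpose hIP'
  have hA' : C' * A' + P' * I'ᵀ = 1 := by
    rw [← hII, ← transpose_map, ← mapMul, ← mapMul, ← mapOne, ← hA]
    ext; simp
  have hAC' : A' * C' = 1 := by rw [← mapMul, hAC, mapOne]
  have hpsi := psi_pos s t a ha P' hPI'
  have hL : (cycleLap a C).PosDef := posDef_transpose_mul_diagonal_mul a ha C' A' hAC'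
  set ψ := psi (2 * k + n') n' s t a with hψ
  set K := C' * (cycleLap a C)⁻¹ * C'ᵀ with hK
  have hKsymm : ∀ i j, K j i = K i j := by
    have hLt : (cycleLap a C)ᵀ = cycleLap a C := by simpa using hL.isHermitian.eq
    have : Kᵀ = K := by
      rw [hK, transpose_mul, transpose_mul, transpose_nonsing_inv, hLt, transpose_transpose,
        Matrix.mul_assoc]
    intro i j
    exact congrFun (congrFun this i) j
  have hdodg : ∀ i j, dodgE (2 * k + n') n' s t a i j = (-1) ^ (i + j : ℕ) * (ψ * K i j) := by
    intro i j
    rw [dodgE_eq s t a hpsi.ne', ← hKsymm, inv_toBlocks₁₁ (diagonal a) I' P' C' A' hIC' hA'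
      (isUnit_iff_ne_zero.2 hL.det_pos.ne')]
    · rfl
    · refine isUnit_iff_ne_zero.2 ?_
      have h1 : ψ = (fromBlocks (diagonal a) I' (-I'ᵀ) 0).det :=
        det_submatrix_equiv_self finSumFinEquiv.symm _
      rw [← h1]
      exact hpsi.ne'
  let G : Finset (Fin (2 * k + n')) → ExteriorAlgebra ℝ (Fin (2 * k + n') → ℝ) := fun S =>
    if h : S.card = 2 * k then
      ((C'.submatrix (S.orderEmbOfFin h) id).det * ∑ τ : Equiv.Perm (Fin (2 * k)), ∏ i,
        K (S.orderEmbOfFin h (τ (evenIdx i))) (S.orderEmbOfFin h (τ (oddIdx i)))) •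
      (List.ofFn fun j => θ _ (S.orderEmbOfFin h j)).prod else 0
  have hφ : phiForm (2 * k + n') n' (2 * k) k rfl s t a C =
      ((((-2) * Real.pi) ^ k)⁻¹ * (Real.sqrt ψ)⁻¹) • ((2 ^ k * (Nat.factorial k : ℝ))⁻¹) •
      ∑ S, G S := by
    have hG := pfaffian_sum_eq C' K
    rw [← hG, ← pfaffian_expansion C' K (θ _) _
      (dLam_mul_mul_dLam_apply C (cycleLap a C)⁻¹)]
    rfl
  rw [hφ, alphaForm, treeSum_alphaTerm rfl rfl]
  have hterm : ∀ T : Finset (Fin (2 * k + n')), alphaTerm (ℓ := 2 * k) rfl s t a T =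
      ((-1) ^ k * ψ ^ k * (q : ℝ)) • G Tᶜ := by
    intro T
    simp only [alphaTerm, G]
    split_ifs with h
    · rw [smul_smul]
      have hT : T.card = n' := by
        have := Finset.card_compl_add_card T
        rw [h, Fintype.card_fin] at this
        omega
      have hTT : Tᶜᶜ.card = n' := by rw [compl_compl, hT]
      have hrow : (I'.submatrix (Tᶜᶜ.orderEmbOfFin hTT) id) = rowSub I' T n' := by
        have : ∀ U, U = T → ∀ hU : U.card = n',
            (I'.submatrix (U.orderEmbOfFin hU) id) = rowSub I' T n' := by
          rintro U rfl hU
          rw [rowSub, dif_pos hU]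
          rfl
        exact this _ (compl_compl T) _
      have hminor := det_rowMinor C' P' I' hIC' hIP' (finSumEquivOfFinset h hTT)
      rw [sign_finSumEquivOfFinset] at hminor
      have hq' : ((fromCols C' P').submatrix id (finSumFinEquiv (m := 2 * k) (n := n')).symm).det
          = q := by
        rw [hq, Int.cast_det]
        congr 1
        ext i j
        simp only [submatrix_apply, map_apply, id]
        rcases finSumFinEquiv.symm j <;> rfl
      have hr : I'.submatrix (finSumEquivOfFinset h hTT ∘ Sum.inr) id = rowSub I' T n' := hrow
      have hl : C'.submatrix (finSumEquivOfFinset h hTT ∘ Sum.inl) id =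
        C'.submatrix (Tᶜ.orderEmbOfFin h) id := rfl
      rw [hq', hr, hl] at hminor
      set f := Tᶜ.orderEmbOfFin h
      have hsign : (∏ i : Fin (2 * k), (-1 : ℤ) ^ ((f i : ℕ) + i)) =
          (∏ i : Fin (2 * k), (-1 : ℤ) ^ (f i : ℕ)) * (-1) ^ k := by
        simp only [pow_add, Finset.prod_mul_distrib, prod_neg_one_pow_val]
      rw [hsign] at hminor
      set ε : ℤ := ∏ i : Fin (2 * k), (-1 : ℤ) ^ (f i : ℕ) with hε
      have hprod : ∀ σ : Equiv.Perm (Fin (2 * k)),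
          (∏ i : Fin k, dodgE (2 * k + n') n' s t a (f (σ (evenIdx i))) (f (σ (oddIdx i)))) =
          ε * ψ ^ k * ∏ i, K (f (σ (evenIdx i))) (f (σ (oddIdx i))) := by
        intro σ
        simp only [hdodg, pow_add]
        rw [Finset.prod_mul_distrib, prod_evenIdx_mul_oddIdx (fun j => (-1 : ℝ) ^ (f (σ j) : ℕ)),
          Equiv.prod_comp σ (fun j => (-1 : ℝ) ^ (f j : ℕ)), Finset.prod_mul_distrib]
        simp [hε, mul_assoc]
      have hkk : ((-1 : ℝ) ^ k) * (-1) ^ k = 1 := by rw [← mul_pow]; simp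
      change (_ * ∑ σ : Equiv.Perm (Fin (2 * k)), ∏ i : Fin k,
        dodgE (2 * k + n') n' s t a (f (σ (evenIdx i))) (f (σ (oddIdx i)))) •
          (List.ofFn fun j : Fin (2 * k) => θ _ (f j)).prod = _
      simp only [hprod, ← Finset.mul_sum]
      congr 1
      rw [← hminor]
      push_cast
      set Z := ∑ τ : Equiv.Perm (Fin (2 * k)), ∏ i, K (f (τ (evenIdx i))) (f (τ (oddIdx i)))
      set d := (rowSub I' T n').det
      linear_combination (-(d * ε * ψ ^ k * Z * (q * q))) * hkk - d * ε * ψ ^ k * Z * hqq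
    · simp
  have hsum : ∑ T, G Tᶜ = ∑ S, G S :=
    Equiv.sum_comp (compl_involutive (α := Finset (Fin (2 * k + n')))).toPerm G
  simp only [hterm, ← Finset.smul_sum, smul_smul, hsum]
  congr 1
  have hrpow : ψ ^ ((((2 * k : ℕ) : ℝ) + 1) / 2) = ψ ^ k * Real.sqrt ψ := by
    rw [Real.sqrt_eq_rpow, ← Real.rpow_natCast, ← Real.rpow_add hpsi]
    congr 1
    push_cast
    ring
  have hsq : Real.sqrt ψ ≠ 0 := (Real.sqrt_pos.2 hpsi).ne'
  have hpi := Real.pi_ne_zero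
  have hpsi0 := hpsi.ne'
  have h2k : ((-2 : ℝ)) ^ k = (-1) ^ k * 2 ^ k := by rw [← mul_pow]; norm_num
  have h4 : (4 : ℝ) ^ (2 * k) = 2 ^ (2 * k) * 2 ^ k * 2 ^ k := by
    rw [mul_assoc, ← mul_pow, pow_mul, pow_mul, ← mul_pow]; norm_num
  have hkk : ((-1 : ℝ) ^ k) * (-1) ^ k = 1 := by rw [← mul_pow]; simp
  have hk0 : ((-1 : ℝ) ^ k)⁻¹ = (-1) ^ k := inv_eq_of_mul_eq_one_left hkk
  rw [hrpow, h4, mul_pow, h2k]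
  simp only [mul_inv, hk0]
  field_simp

end GraphForms
end

section
/- Tutte's lemma on cycle minors. Let G be a connected graph, 𝒞 a cycle incidence matrix of G, and U ⊆ E a subset of edges with |U| = n − 1. Then det(𝒞[E∖U]) ∈ {−1, 0, +1}, and det(𝒞[E∖U]) ≠ 0 if and only if U is a spanning tree of G. -/
open Matrix BigOperators

namespace GraphForms

section

variable {m n' : ℕ} {s t : Fin m → Fin (n' + 1)}

lemma rowSub_eq_submatrix {R : Type*} [Zero R] {c k : ℕ} (X : Matrix (Fin m) (Fin c) R)
    {S : Finset (Fin m)} (h : S.card = k) :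
    rowSub X S k = X.submatrix (S.orderEmbOfFin h) id := by
  ext i j
  simp [rowSub, h]

/-- A path in `T` from `x` to `y` yields an integral chain supported on `T` with boundary
`y - x`. -/
lemma Conn.exists_chain {T : Set (Fin m)} {x y : Fin (n' + 1)} (h : Conn m (n' + 1) s t T x y) :
    ∃ p : Fin m → ℤ, (∀ e ∉ T, p e = 0) ∧ ∀ j : Fin n', ((inc ℤ m n' s t)ᵀ *ᵥ p) j =
      (if y = j.castSucc then 1 else 0) - (if x = j.castSucc then 1 else 0) := by
  induction h with
  | refl => exact ⟨0, by simp, by simp⟩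
  | tail _ hbc ih =>
    obtain ⟨p, hp, hpj⟩ := ih
    obtain ⟨e, he, ⟨rfl, rfl⟩ | ⟨rfl, rfl⟩⟩ := hbc
    · refine ⟨p + Pi.single e 1, fun f hf => ?_, fun j => ?_⟩
      · have hne : f ≠ e := fun h => hf (h ▸ he)
        simp [hp f hf, hne]
      · rw [mulVec_add, Pi.add_apply, hpj]
        simp [inc]
    · refine ⟨p - Pi.single e 1, fun f hf => ?_, fun j => ?_⟩
      · have hne : f ≠ e := fun h => hf (h ▸ he)
        simp [hp f hf, hne]
      · rw [mulVec_sub, Pi.sub_apply, hpj]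
        simp [inc]

/-- If `T` connects all vertices, every integral boundary is attained by a chain supported
on `T`. -/
lemma exists_chain_of_forall_conn {T : Set (Fin m)}
    (h : ∀ x y, Conn m (n' + 1) s t T x y) (b : Fin n' → ℤ) :
    ∃ p : Fin m → ℤ, (∀ e ∉ T, p e = 0) ∧ (inc ℤ m n' s t)ᵀ *ᵥ p = b := by
  choose p hp hpj using fun i : Fin n' => (h (Fin.last n') i.castSucc).exists_chain
  refine ⟨∑ i, b i • p i, fun e he => by simp [hp _ e he], funext fun j => ?_⟩
  have hlast : Fin.last n' ≠ j.castSucc := (Fin.castSucc_lt_last j).ne'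
  simp only [mulVec_sum, mulVec_smul, Finset.sum_apply, Pi.smul_apply, hpj]
  simp [hlast]

lemma isUnit_det_rowSub_compl {ℓ : ℕ} {C : Matrix (Fin m) (Fin ℓ) ℤ}
    (hC : IsCycleMatrix m n' ℓ s t C) {U : Finset (Fin m)} (hU : Uᶜ.card = ℓ)
    (h : ∀ x y, Conn m (n' + 1) s t ↑U x y) : IsUnit (rowSub C Uᶜ ℓ).det := by
  rw [← Matrix.isUnit_iff_isUnit_det, ← Matrix.mulVec_surjective_iff_isUnit,
    rowSub_eq_submatrix C hU]
  intro y
  set ι := Uᶜ.orderEmbOfFin hU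
  obtain ⟨p, hp, hpb⟩ := exists_chain_of_forall_conn h
    ((inc ℤ m n' s t)ᵀ *ᵥ Function.extend ι y 0)
  obtain ⟨c, hc, -⟩ := hC.2 (Function.extend ι y 0 - p) (by rw [mulVec_sub, hpb, sub_self])
  refine ⟨c, funext fun i => ?_⟩
  have hi : p (ι i) = 0 := hp _ (Finset.mem_compl.mp (Uᶜ.orderEmbOfFin_mem hU i))
  have := congrFun hc (ι i)
  rwa [Pi.sub_apply, ι.injective.extend_apply, hi, sub_zero] at this

lemma Conn.symm {n : ℕ} {s t : Fin m → Fin n} {T : Set (Fin m)} {x y : Fin n}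
    (h : Conn m n s t T x y) : Conn m n s t T y x :=
  have : Std.Symm fun a b => ∃ e ∈ T, (s e = a ∧ t e = b) ∨ (s e = b ∧ t e = a) :=
    ⟨fun _ _ ⟨e, he, h⟩ => ⟨e, he, h.symm⟩⟩
  Relation.ReflTransGen.stdSymm.symm _ _ h

lemma inc_mulVec (g : Fin (n' + 1) → ℤ) (hg : g (Fin.last n') = 0) (e : Fin m) :
    (inc ℤ m n' s t *ᵥ fun j => g j.castSucc) e = g (t e) - g (s e) := by
  have key (v : Fin (n' + 1)) :
      ∑ j : Fin n', (if v = j.castSucc then g j.castSucc else 0) = g v := by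
    have := Fin.sum_univ_castSucc fun i => if v = i then g i else 0
    simpa [hg] using this.symm
  simp [inc, mulVec, dotProduct, sub_mul, key]

/-- A set of `n - 1` edges that does not connect all vertices supports a nonzero cycle. -/
lemma exists_cycle_of_not_conn {U : Finset (Fin m)} (hU : U.card = n')
    (h : ¬ ∀ x y, Conn m (n' + 1) s t ↑U x y) :
    ∃ z : Fin m → ℤ, z ≠ 0 ∧ (∀ e ∉ U, z e = 0) ∧ (inc ℤ m n' s t)ᵀ *ᵥ z = 0 := by
  classical
  obtain ⟨v, hv⟩ : ∃ v, ¬ Conn m (n' + 1) s t ↑U v (Fin.last n') := by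
    by_contra! hall
    exact h fun x y => (hall x).trans (hall y).symm
  set g : Fin (n' + 1) → ℤ := fun w => if Conn m (n' + 1) s t ↑U w (Fin.last n') then 0 else 1
    with hgdef
  have hglast : g (Fin.last n') = 0 := if_pos Relation.ReflTransGen.refl
  have hgedge : ∀ e ∈ U, g (t e) = g (s e) := by
    intro e he
    have h1 : Conn m (n' + 1) s t ↑U (s e) (t e) := .single ⟨e, he, .inl ⟨rfl, rfl⟩⟩
    have h2 : Conn m (n' + 1) s t ↑U (t e) (Fin.last n') ↔
        Conn m (n' + 1) s t ↑U (s e) (Fin.last n') := ⟨h1.trans, h1.symm.trans⟩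
    simp [hgdef, h2]
  set ι := U.orderEmbOfFin hU
  have hdet : ((inc ℤ m n' s t).submatrix ι id).det = 0 := by
    refine Matrix.exists_mulVec_eq_zero_iff.mp ⟨fun j => g j.castSucc, fun h0 => ?_, ?_⟩
    · obtain ⟨j, rfl⟩ : ∃ j : Fin n', j.castSucc = v :=
        Fin.exists_castSucc_eq.mpr fun hlast => hv (hlast ▸ Relation.ReflTransGen.refl)
      simpa [hgdef, hv] using congrFun h0 j
    · funext i
      have := inc_mulVec (s := s) (t := t) g hglast (ι i)
      rwa [hgedge _ (U.orderEmbOfFin_mem hU i), sub_self] at this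
  obtain ⟨z, hz, hz0⟩ := Matrix.exists_vecMul_eq_zero_iff.mpr hdet
  refine ⟨Function.extend ι z 0, fun h0 => hz (funext fun i => ?_), fun e he => ?_,
    funext fun j => ?_⟩
  · simpa [ι.injective.extend_apply] using congrFun h0 (ι i)
  · refine Function.extend_apply' _ _ _ ?_
    rintro ⟨i, rfl⟩
    exact he (U.orderEmbOfFin_mem hU i)
  · rw [← congrFun hz0 j, mulVec_transpose]
    refine (Fintype.sum_of_injective ι ι.injective _ _ (fun e he => ?_) fun i => ?_).symm
    · rw [Function.extend_apply' _ _ _ he, Pi.zero_apply, zero_mul]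
    · rw [ι.injective.extend_apply]
      rfl

lemma det_rowSub_compl_eq_zero {ℓ : ℕ} {C : Matrix (Fin m) (Fin ℓ) ℤ}
    (hC : IsCycleMatrix m n' ℓ s t C) {U : Finset (Fin m)} (hU : U.card = n')
    (hU' : Uᶜ.card = ℓ) (h : ¬ ∀ x y, Conn m (n' + 1) s t ↑U x y) :
    (rowSub C Uᶜ ℓ).det = 0 := by
  obtain ⟨z, hz, hzU, hcyc⟩ := exists_cycle_of_not_conn hU h
  obtain ⟨c, rfl, -⟩ := hC.2 z hcyc
  rw [rowSub_eq_submatrix C hU']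
  refine Matrix.exists_mulVec_eq_zero_iff.mp
    ⟨c, fun hc => hz (by rw [hc, mulVec_zero]), funext fun i => ?_⟩
  exact hzU _ (Finset.mem_compl.mp (Uᶜ.orderEmbOfFin_mem hU' i))

end

/-- **Tutte's lemma on cycle minors.** -/
theorem tutte_cycle_minor (m n' ℓ : ℕ) (s t : Fin m → Fin (n' + 1))
    (hconn : IsConnectedGraph m (n' + 1) s t) (hm : ℓ + n' = m)
    (C : Matrix (Fin m) (Fin ℓ) ℤ) (hC : IsCycleMatrix m n' ℓ s t C)
    (U : Finset (Fin m)) (hU : U.card = n') :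
    (rowSub C Uᶜ ℓ).det ∈ ({-1, 0, 1} : Set ℤ) ∧
    ((rowSub C Uᶜ ℓ).det ≠ 0 ↔ IsSpanningTree m (n' + 1) s t U) := by
  have hU' : Uᶜ.card = ℓ := by
    rw [Finset.card_compl, Fintype.card_fin]
    omega
  by_cases h : ∀ x y, Conn m (n' + 1) s t ↑U x y
  · have hunit := isUnit_det_rowSub_compl hC hU' h
    refine ⟨?_, fun _ => ⟨hU, h⟩, fun _ => hunit.ne_zero⟩
    rcases Int.isUnit_iff.mp hunit with h1 | h1 <;> simp [h1]
  · have hzero := det_rowSub_compl_eq_zero hC hU hU' h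
    exact ⟨by simp [hzero], fun hne => absurd hzero hne, fun hT => absurd hT.2 h⟩
end GraphForms
end
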